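/- For all a1, a2, a3, a4 in F, the standard polynomial of degree 4 vanishes: the sum over all permutations sigma of {1,2,3,4} of sgn(sigma) a_{sigma(1)} a_{sigma(2)} a_{sigma(3)} a_{sigma(4)} equals 0. That is, s4 is a polynomial identity of F. -/

import Mathlib

open scoped TensorProduct

noncomputable section

/-- The free supercommutative algebra on four even variables `x1, x2, x1', x2'` and four odd
variables `y1, y2, y1', y2'`: the tensor product of a polynomial ring in four variables with
the exterior algebra on a four-dimensional space. -/
abbrev FreeSuperComm (K : Type*) [Field K] :=
  (MvPolynomial (Fin 4) K) ⊗[K] (ExteriorAlgebra K (Fin 4 → K))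

/-- The even generators: `xg K 0 = x1`, `xg K 1 = x1'`, `xg K 2 = x2`, `xg K 3 = x2'`. -/
def xg (K : Type*) [Field K] (i : Fin 4) : FreeSuperComm K :=
  (MvPolynomial.X i) ⊗ₜ[K] 1

/-- The odd generators: `yg K 0 = y1`, `yg K 1 = y1'`, `yg K 2 = y2`, `yg K 3 = y2'`. -/
def yg (K : Type*) [Field K] (i : Fin 4) : FreeSuperComm K :=
  1 ⊗ₜ[K] (ExteriorAlgebra.ι K (Pi.single i 1))

/-- The generic matrix `C1 = (x1, y1; y1', x1')`. -/
def genC₁ (K : Type*) [Field K] : Matrix (Fin 2) (Fin 2) (FreeSuperComm K) :=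
  !![xg K 0, yg K 0; yg K 1, xg K 1]

/-- The generic matrix `C2 = (x2, y2; y2', x2')`. -/
def genC₂ (K : Type*) [Field K] : Matrix (Fin 2) (Fin 2) (FreeSuperComm K) :=
  !![xg K 2, yg K 2; yg K 3, xg K 3]

/-- `F = K[C1, C2]`, the unital subalgebra generated by the two generic matrices. -/
def Falg (K : Type*) [Field K] : Subalgebra K (Matrix (Fin 2) (Fin 2) (FreeSuperComm K)) :=
  Algebra.adjoin K {genC₁ K, genC₂ K}

theorem s4_expand {M : Type*} [Ring M] (a : Fin 4 → M) :
    ∑ σ : Equiv.Perm (Fin 4),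
      (Equiv.Perm.sign σ : ℤ) • (a (σ 0) * a (σ 1) * a (σ 2) * a (σ 3)) =
    ((a 0 * a 1 - a 1 * a 0) * (a 2 * a 3 - a 3 * a 2)
      + (a 2 * a 3 - a 3 * a 2) * (a 0 * a 1 - a 1 * a 0))
    - ((a 0 * a 2 - a 2 * a 0) * (a 1 * a 3 - a 3 * a 1)
      + (a 1 * a 3 - a 3 * a 1) * (a 0 * a 2 - a 2 * a 0))
    + ((a 0 * a 3 - a 3 * a 0) * (a 1 * a 2 - a 2 * a 1)
      + (a 1 * a 2 - a 2 * a 1) * (a 0 * a 3 - a 3 * a 0)) := by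
  have g2 : ∀ (p : Fin 4) (e : Equiv.Perm (Fin 3)), Equiv.Perm.decomposeFin.symm (p, e) 2
      = Equiv.swap 0 p (e 1).succ := fun p e => Equiv.Perm.decomposeFin_symm_apply_succ e p 1
  have g3 : ∀ (p : Fin 4) (e : Equiv.Perm (Fin 3)), Equiv.Perm.decomposeFin.symm (p, e) 3
      = Equiv.swap 0 p (e 2).succ := fun p e => Equiv.Perm.decomposeFin_symm_apply_succ e p 2
  have k2 : ∀ (p : Fin 3) (e : Equiv.Perm (Fin 2)), Equiv.Perm.decomposeFin.symm (p, e) 2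
      = Equiv.swap 0 p (e 1).succ := fun p e => Equiv.Perm.decomposeFin_symm_apply_succ e p 1
  have n1 : (1 : Fin 3).succ = (2 : Fin 4) := rfl
  have n2 : (2 : Fin 3).succ = (3 : Fin 4) := rfl
  have n3 : (1 : Fin 2).succ = (2 : Fin 3) := rfl
  rw [← Equiv.sum_comp Equiv.Perm.decomposeFin.symm, Fintype.sum_prod_type]
  simp only [← Equiv.sum_comp (Equiv.Perm.decomposeFin (n := 2)).symm, Fintype.sum_prod_type,
    ← Equiv.sum_comp (Equiv.Perm.decomposeFin (n := 1)).symm,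
    Fin.sum_univ_succ, Fintype.sum_unique]
  simp [g2, g3, k2, n1, n2, n3, Equiv.Perm.decomposeFin.symm_sign, Equiv.Perm.decomposeFin_symm_apply_zero,
     Equiv.swap_apply_def]
  noncomm_ring

set_option linter.all false
section S4abs
variable {P Z R : Type*} [CommRing P] [IsDomain P] [CommRing Z] [Ring R] [Algebra Z R]

/-- Abstract data for the identity. -/
structure S4Data (i : P →+* Z) (e : Z →+* P) (d1 d2 : P) (y1 y2 z1 z2 : R)
    (c11 c12 c21 c22 : Z) : Prop where
  ei : ∀ p, e (i p) = p
  d1_ne : d1 ≠ 0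
  inj : Function.Injective (algebraMap Z R)
  y1z1 : y1 * z1 = c11 • (1 : R)
  y1z2 : y1 * z2 = c12 • (1 : R)
  y2z1 : y2 * z1 = c21 • (1 : R)
  y2z2 : y2 * z2 = c22 • (1 : R)
  z1y1 : z1 * y1 = -(c11 • (1 : R))
  z2y1 : z2 * y1 = -(c12 • (1 : R))
  z1y2 : z1 * y2 = -(c21 • (1 : R))
  z2y2 : z2 * y2 = -(c22 • (1 : R))
  y11 : y1 * y1 = 0
  y22 : y2 * y2 = 0
  y21 : y2 * y1 = -(y1 * y2)
  z11 : z1 * z1 = 0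
  z22 : z2 * z2 = 0
  z21 : z2 * z1 = -(z1 * z2)
  e11 : e c11 = 0
  e12 : e c12 = 0
  e21 : e c21 = 0
  e22 : e c22 = 0

/-- Elements that act on the four cubic monomials through their constant term. -/
def S4Good (i : P →+* Z) (e : Z →+* P) (c11 c12 c21 : Z) (y2 z2 : R) (z : Z) : Prop :=
  (c11 * z) • y2 = (c11 * i (e z)) • y2 ∧ (c12 * z) • y2 = (c12 * i (e z)) • y2 ∧
  (c11 * z) • z2 = (c11 * i (e z)) • z2 ∧ (c21 * z) • z2 = (c21 * i (e z)) • z2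

theorem S4Good.add {i : P →+* Z} {e : Z →+* P} {c11 c12 c21 : Z} {y2 z2 : R} {z w : Z}
    (hz : S4Good i e c11 c12 c21 y2 z2 z) (hw : S4Good i e c11 c12 c21 y2 z2 w) :
    S4Good i e c11 c12 c21 y2 z2 (z + w) := by
  obtain ⟨h1, h2, h3, h4⟩ := hz
  obtain ⟨k1, k2, k3, k4⟩ := hw
  refine ⟨?_, ?_, ?_, ?_⟩ <;> simp only [map_add, mul_add, add_smul, *]

theorem S4Good.mul {i : P →+* Z} {e : Z →+* P} {c11 c12 c21 : Z} {y2 z2 : R} {z w : Z}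
    (hz : S4Good i e c11 c12 c21 y2 z2 z) (hw : S4Good i e c11 c12 c21 y2 z2 w) :
    S4Good i e c11 c12 c21 y2 z2 (z * w) := by
  obtain ⟨h1, h2, h3, h4⟩ := hz
  obtain ⟨k1, k2, k3, k4⟩ := hw
  have key : ∀ (c : Z) (y : R), (c * z) • y = (c * i (e z)) • y → (c * w) • y = (c * i (e w)) • y →
      (c * (z * w)) • y = (c * i (e (z * w))) • y := by
    intro c y h k
    rw [map_mul, map_mul]
    linear_combination (norm := module) w • h + (i (e z)) • k
  exact ⟨key _ _ h1 k1, key _ _ h2 k2, key _ _ h3 k3, key _ _ h4 k4⟩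

variable {i : P →+* Z} {e : Z →+* P} {d1 d2 : P} {y1 y2 z1 z2 : R}
    {c11 c12 c21 c22 : Z}

theorem S4Data.good_i (H : S4Data i e d1 d2 y1 y2 z1 z2 c11 c12 c21 c22) (p : P) :
    S4Good i e c11 c12 c21 y2 z2 (i p) := by
  simp [S4Good, H.ei]

theorem S4Data.rels (H : S4Data i e d1 d2 y1 y2 z1 z2 c11 c12 c21 c22) :
    c11 * c11 = 0 ∧ c11 * c12 = 0 ∧ c11 * c21 = 0 ∧ c12 * c12 = 0 ∧ c12 * c22 = 0 ∧
    c21 * c21 = 0 ∧ c21 * c22 = 0 ∧ c22 * c22 = 0 ∧ c12 * c21 = - (c11 * c22) := by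
  have a11 : algebraMap Z R c11 = y1 * z1 := by rw [H.y1z1, Algebra.algebraMap_eq_smul_one]
  have a12 : algebraMap Z R c12 = y1 * z2 := by rw [H.y1z2, Algebra.algebraMap_eq_smul_one]
  have a21 : algebraMap Z R c21 = y2 * z1 := by rw [H.y2z1, Algebra.algebraMap_eq_smul_one]
  have a22 : algebraMap Z R c22 = y2 * z2 := by rw [H.y2z2, Algebra.algebraMap_eq_smul_one]
  have b11 : z1 * y1 = - (y1 * z1) := by rw [H.z1y1, H.y1z1]
  have b21 : z2 * y1 = - (y1 * z2) := by rw [H.z2y1, H.y1z2]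
  have b12 : z1 * y2 = - (y2 * z1) := by rw [H.z1y2, H.y2z1]
  have b22 : z2 * y2 = - (y2 * z2) := by rw [H.z2y2, H.y2z2]
  have q : ∀ a b c d : R, b * c = -(c * b) → a * b * (c * d) = - (a * c * (b * d)) := by
    intro a b c d h
    calc a * b * (c * d) = a * (b * c) * d := by noncomm_ring
      _ = _ := by rw [h]; noncomm_ring
  refine ⟨?_, ?_, ?_, ?_, ?_, ?_, ?_, ?_, ?_⟩ <;> apply H.inj <;>
    simp only [map_mul, map_neg, map_zero, a11, a12, a21, a22]
  · rw [q _ _ _ _ b11, H.y11]; simp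
  · rw [q _ _ _ _ b11, H.y11]; simp
  · rw [q _ _ _ _ b12, H.z11]; simp
  · rw [q _ _ _ _ b21, H.y11]; simp
  · rw [q _ _ _ _ b22, H.z22]; simp
  · rw [q _ _ _ _ b12, H.y22]; simp
  · rw [q _ _ _ _ b12, H.y22]; simp
  · rw [q _ _ _ _ b22, H.y22]; simp
  · rw [q _ _ _ _ b22, q _ _ _ _ b12, H.z21]; simp

/-- action of the quadratic elements on the linear ones -/
theorem S4Data.acts (H : S4Data i e d1 d2 y1 y2 z1 z2 c11 c12 c21 c22) :
    c11 • y1 = 0 ∧ c12 • y1 = 0 ∧ c21 • y2 = 0 ∧ c22 • y2 = 0 ∧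
    c21 • y1 = - (c11 • y2) ∧ c22 • y1 = - (c12 • y2) ∧
    c11 • z1 = 0 ∧ c21 • z1 = 0 ∧ c12 • z2 = 0 ∧ c22 • z2 = 0 ∧
    c12 • z1 = - (c11 • z2) ∧ c22 • z1 = - (c21 • z2) := by
  have a11 : ∀ r : R, c11 • r = y1 * z1 * r := fun r => by rw [H.y1z1, smul_mul_assoc, one_mul]
  have a12 : ∀ r : R, c12 • r = y1 * z2 * r := fun r => by rw [H.y1z2, smul_mul_assoc, one_mul]
  have a21 : ∀ r : R, c21 • r = y2 * z1 * r := fun r => by rw [H.y2z1, smul_mul_assoc, one_mul]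
  have a22 : ∀ r : R, c22 • r = y2 * z2 * r := fun r => by rw [H.y2z2, smul_mul_assoc, one_mul]
  have b11 : z1 * y1 = - (y1 * z1) := by rw [H.z1y1, H.y1z1]
  have b21 : z2 * y1 = - (y1 * z2) := by rw [H.z2y1, H.y1z2]
  have b12 : z1 * y2 = - (y2 * z1) := by rw [H.z1y2, H.y2z1]
  have b22 : z2 * y2 = - (y2 * z2) := by rw [H.z2y2, H.y2z2]
  simp only [a11, a12, a21, a22]
  refine ⟨?_, ?_, ?_, ?_, ?_, ?_, ?_, ?_, ?_, ?_, ?_, ?_⟩ <;>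
    simp only [mul_assoc, H.z11, H.z22, b11, b12, b21, b22, H.z21, mul_neg, mul_zero, neg_zero,
      neg_neg] <;>
    simp only [← mul_assoc, H.y11, H.y22, H.y21, zero_mul, neg_zero, neg_mul, neg_neg]

theorem S4Data.good_c (H : S4Data i e d1 d2 y1 y2 z1 z2 c11 c12 c21 c22) :
    S4Good i e c11 c12 c21 y2 z2 c11 ∧ S4Good i e c11 c12 c21 y2 z2 c12 ∧
    S4Good i e c11 c12 c21 y2 z2 c21 ∧ S4Good i e c11 c12 c21 y2 z2 c22 := by
  obtain ⟨r1, r2, r3, r4, r5, r6, r7, r8, r9⟩ := H.rels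
  obtain ⟨s1, s2, s3, s4, s5, s6, s7, s8, s9, s10, s11, s12⟩ := H.acts
  have t1 : (c11 * c22) • y2 = 0 := by rw [mul_smul, s4, smul_zero]
  have t2 : (c11 * c22) • z2 = 0 := by rw [mul_smul, s10, smul_zero]
  have r2' := mul_comm c12 c11
  have r3' := mul_comm c21 c11
  have r9' := mul_comm c21 c12
  refine ⟨?_, ?_, ?_, ?_⟩ <;> unfold S4Good <;>
    simp only [H.e11, H.e12, H.e21, H.e22, map_zero, mul_zero, zero_smul, r1, r2', r2, r3, r4, r5,
      r6, r7, r8, r3', r9', r9, neg_smul, t1, t2, neg_zero, and_self]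

/-- Matrices of the shape occurring in the algebra. -/
def S4Mat (i : P →+* Z) (e : Z →+* P) (d1 d2 : P) (c11 c12 c21 c22 : Z) (y1 z1 y2 z2 : R)
    (A : Matrix (Fin 2) (Fin 2) R) : Prop :=
  ∃ p t a1 a2 b1 b2 : Z, (S4Good i e c11 c12 c21 y2 z2 p ∧
    S4Good i e c11 c12 c21 y2 z2 t ∧ S4Good i e c11 c12 c21 y2 z2 a1 ∧
    S4Good i e c11 c12 c21 y2 z2 a2 ∧ S4Good i e c11 c12 c21 y2 z2 b1 ∧
    S4Good i e c11 c12 c21 y2 z2 b2) ∧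
    e p = e t + e a1 * d1 + e a2 * d2 ∧ e p = e t + e b1 * d1 + e b2 * d2 ∧
    A = !![p • (1 : R), a1 • y1 + a2 • y2; b1 • z1 + b2 • z2, t • (1 : R)]

theorem S4Mat.add {A B : Matrix (Fin 2) (Fin 2) R}
    (hA : S4Mat i e d1 d2 c11 c12 c21 c22 y1 z1 y2 z2 A)
    (hB : S4Mat i e d1 d2 c11 c12 c21 c22 y1 z1 y2 z2 B) :
    S4Mat i e d1 d2 c11 c12 c21 c22 y1 z1 y2 z2 (A + B) := by
  obtain ⟨p, t, a1, a2, b1, b2, ⟨g1, g2, g3, g4, g5, g6⟩, h1, h2, rfl⟩ := hA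
  obtain ⟨p', t', a1', a2', b1', b2', ⟨g1', g2', g3', g4', g5', g6'⟩, h1', h2', rfl⟩ := hB
  refine ⟨p + p', t + t', a1 + a1', a2 + a2', b1 + b1', b2 + b2',
    ⟨g1.add g1', g2.add g2', g3.add g3', g4.add g4', g5.add g5', g6.add g6'⟩, ?_, ?_, ?_⟩
  · simp only [map_add]; linear_combination h1 + h1'
  · simp only [map_add]; linear_combination h2 + h2'
  · ext k l; fin_cases k <;> fin_cases l <;> simp <;> module

theorem S4Data.mulUV (H : S4Data i e d1 d2 y1 y2 z1 z2 c11 c12 c21 c22) (a1 a2 b1 b2 : Z) :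
    (a1 • y1 + a2 • y2) * (b1 • z1 + b2 • z2) =
      (a1 * b1 * c11 + a1 * b2 * c12 + a2 * b1 * c21 + a2 * b2 * c22) • (1 : R) := by
  simp only [add_mul, mul_add, smul_mul_assoc, mul_smul_comm, H.y1z1, H.y1z2, H.y2z1, H.y2z2]
  module

theorem S4Data.mulVU (H : S4Data i e d1 d2 y1 y2 z1 z2 c11 c12 c21 c22) (a1 a2 b1 b2 : Z) :
    (b1 • z1 + b2 • z2) * (a1 • y1 + a2 • y2) =
      (-(a1 * b1 * c11 + a1 * b2 * c12 + a2 * b1 * c21 + a2 * b2 * c22)) • (1 : R) := by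
  simp only [add_mul, mul_add, smul_mul_assoc, mul_smul_comm, H.z1y1, H.z1y2, H.z2y1, H.z2y2]
  module

theorem S4Data.mul_aux (H : S4Data i e d1 d2 y1 y2 z1 z2 c11 c12 c21 c22)
    (p t a1 a2 b1 b2 p' t' a1' a2' b1' b2' : Z) :
    (!![p • (1 : R), a1 • y1 + a2 • y2; b1 • z1 + b2 • z2, t • (1 : R)] :
      Matrix (Fin 2) (Fin 2) R) *
    !![p' • (1 : R), a1' • y1 + a2' • y2; b1' • z1 + b2' • z2, t' • (1 : R)] =
    !![(p * p' + (a1 * b1' * c11 + a1 * b2' * c12 + a2 * b1' * c21 + a2 * b2' * c22)) • (1 : R),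
      (p * a1' + a1 * t') • y1 + (p * a2' + a2 * t') • y2;
      (b1 * p' + t * b1') • z1 + (b2 * p' + t * b2') • z2,
      (t * t' + (-(a1' * b1 * c11 + a1' * b2 * c12 + a2' * b1 * c21 + a2' * b2 * c22))) • (1 : R)]
      := by
  rw [Matrix.mul_fin_two, H.mulUV, H.mulVU]
  simp only [smul_mul_assoc, mul_smul_comm, one_mul, mul_one]
  ext k l; fin_cases k <;> fin_cases l <;> simp <;> module

theorem S4Data.mat_mul (H : S4Data i e d1 d2 y1 y2 z1 z2 c11 c12 c21 c22)
    {A B : Matrix (Fin 2) (Fin 2) R}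
    (hA : S4Mat i e d1 d2 c11 c12 c21 c22 y1 z1 y2 z2 A)
    (hB : S4Mat i e d1 d2 c11 c12 c21 c22 y1 z1 y2 z2 B) :
    S4Mat i e d1 d2 c11 c12 c21 c22 y1 z1 y2 z2 (A * B) := by
  obtain ⟨p, t, a1, a2, b1, b2, ⟨g1, g2, g3, g4, g5, g6⟩, h1, h2, rfl⟩ := hA
  obtain ⟨p', t', a1', a2', b1', b2', ⟨g1', g2', g3', g4', g5', g6'⟩, h1', h2', rfl⟩ := hB
  obtain ⟨k11, k12, k21, k22⟩ := H.good_c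
  have gn : S4Good i e c11 c12 c21 y2 z2 (-1) := by
    have := H.good_i (-1); simpa using this
  refine ⟨_, _, _, _, _, _, ⟨?_, ?_, ?_, ?_, ?_, ?_⟩, ?_, ?_, H.mul_aux ..⟩
  · exact (g1.mul g1').add (((((g3.mul g5').mul k11).add ((g3.mul g6').mul k12)).add
      ((g4.mul g5').mul k21)).add ((g4.mul g6').mul k22))
  · rw [neg_eq_neg_one_mul]
    exact (g2.mul g2').add (gn.mul (((((g3'.mul g5).mul k11).add ((g3'.mul g6).mul k12)).add
      ((g4'.mul g5).mul k21)).add ((g4'.mul g6).mul k22)))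
  · exact (g1.mul g3').add (g3.mul g2')
  · exact (g1.mul g4').add (g4.mul g2')
  · exact (g5.mul g1').add (g2.mul g5')
  · exact (g6.mul g1').add (g2.mul g6')
  · simp only [map_add, map_mul, map_neg, H.e11, H.e12, H.e21, H.e22]
    linear_combination (e t') * h1 + e p * h1'
  · simp only [map_add, map_mul, map_neg, H.e11, H.e12, H.e21, H.e22]
    linear_combination (e p') * h2 + e t * h2'

theorem S4Data.comm_aux (H : S4Data i e d1 d2 y1 y2 z1 z2 c11 c12 c21 c22)
    (p t a1 a2 b1 b2 p' t' a1' a2' b1' b2' : Z) :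
    (!![p • (1 : R), a1 • y1 + a2 • y2; b1 • z1 + b2 • z2, t • (1 : R)] :
      Matrix (Fin 2) (Fin 2) R) *
    !![p' • (1 : R), a1' • y1 + a2' • y2; b1' • z1 + b2' • z2, t' • (1 : R)] -
    !![p' • (1 : R), a1' • y1 + a2' • y2; b1' • z1 + b2' • z2, t' • (1 : R)] *
    !![p • (1 : R), a1 • y1 + a2 • y2; b1 • z1 + b2 • z2, t • (1 : R)] =
    !![((a1 * b1' - a1' * b1) * c11 + (a1 * b2' - a1' * b2) * c12 + (a2 * b1' - a2' * b1) * c21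
        + (a2 * b2' - a2' * b2) * c22) • (1 : R),
      ((p - t) * a1' - (p' - t') * a1) • y1 + ((p - t) * a2' - (p' - t') * a2) • y2;
      (-((p - t) * b1' - (p' - t') * b1)) • z1 + (-((p - t) * b2' - (p' - t') * b2)) • z2,
      ((a1 * b1' - a1' * b1) * c11 + (a1 * b2' - a1' * b2) * c12 + (a2 * b1' - a2' * b1) * c21
        + (a2 * b2' - a2' * b2) * c22) • (1 : R)] := by
  rw [H.mul_aux, H.mul_aux]
  ext k l; fin_cases k <;> fin_cases l <;> simp <;> module

theorem S4Data.jordan_aux (H : S4Data i e d1 d2 y1 y2 z1 z2 c11 c12 c21 c22)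
    (m11 m12 m21 m22 a1 a2 b1 b2 m11' m12' m21' m22' a1' a2' b1' b2' : Z) :
    (!![(m11 * c11 + m12 * c12 + m21 * c21 + m22 * c22) • (1 : R), a1 • y1 + a2 • y2;
        b1 • z1 + b2 • z2, (m11 * c11 + m12 * c12 + m21 * c21 + m22 * c22) • (1 : R)] :
      Matrix (Fin 2) (Fin 2) R) *
    !![(m11' * c11 + m12' * c12 + m21' * c21 + m22' * c22) • (1 : R), a1' • y1 + a2' • y2;
        b1' • z1 + b2' • z2, (m11' * c11 + m12' * c12 + m21' * c21 + m22' * c22) • (1 : R)] +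
    !![(m11' * c11 + m12' * c12 + m21' * c21 + m22' * c22) • (1 : R), a1' • y1 + a2' • y2;
        b1' • z1 + b2' • z2, (m11' * c11 + m12' * c12 + m21' * c21 + m22' * c22) • (1 : R)] *
    !![(m11 * c11 + m12 * c12 + m21 * c21 + m22 * c22) • (1 : R), a1 • y1 + a2 • y2;
        b1 • z1 + b2 • z2, (m11 * c11 + m12 * c12 + m21 * c21 + m22 * c22) • (1 : R)] =
    !![(2 * (m11 * m22' + m22 * m11' - m12 * m21' - m21 * m12') * (c11 * c22)
        + ((a1 * b1' + a1' * b1) * c11 + (a1 * b2' + a1' * b2) * c12 + (a2 * b1' + a2' * b1) * c21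
        + (a2 * b2' + a2' * b2) * c22)) • (1 : R),
      (2 * (m11 * a2' - m21 * a1' + m11' * a2 - m21' * a1)) • (c11 • y2)
      + (2 * (m12 * a2' - m22 * a1' + m12' * a2 - m22' * a1)) • (c12 • y2);
      (2 * (m11 * b2' - m12 * b1' + m11' * b2 - m12' * b1)) • (c11 • z2)
      + (2 * (m21 * b2' - m22 * b1' + m21' * b2 - m22' * b1)) • (c21 • z2),
      (2 * (m11 * m22' + m22 * m11' - m12 * m21' - m21 * m12') * (c11 * c22)
        - ((a1 * b1' + a1' * b1) * c11 + (a1 * b2' + a1' * b2) * c12 + (a2 * b1' + a2' * b1) * c21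
        + (a2 * b2' + a2' * b2) * c22)) • (1 : R)] := by
  obtain ⟨r1, r2, r3, r4, r5, r6, r7, r8, r9⟩ := H.rels
  obtain ⟨s1, s2, s3, s4, s5, s6, s7, s8, s9, s10, s11, s12⟩ := H.acts
  have hSS : (m11 * c11 + m12 * c12 + m21 * c21 + m22 * c22) *
      (m11' * c11 + m12' * c12 + m21' * c21 + m22' * c22) =
      (m11 * m22' + m22 * m11' - m12 * m21' - m21 * m12') * (c11 * c22) := by
    linear_combination m11 * m11' * r1 + (m11 * m12' + m12 * m11') * r2
      + (m11 * m21' + m21 * m11') * r3 + m12 * m12' * r4 + (m12 * m22' + m22 * m12') * r5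
      + m21 * m21' * r6 + (m21 * m22' + m22 * m21') * r7 + m22 * m22' * r8
      + (m12 * m21' + m21 * m12') * r9
  have hY : ∀ m11 m12 m21 m22 a1 a2 : Z, (m11 * c11 + m12 * c12 + m21 * c21 + m22 * c22) •
      (a1 • y1 + a2 • y2) = (m11 * a2 - m21 * a1) • (c11 • y2) + (m12 * a2 - m22 * a1) • (c12 • y2)
      := by
    intro m11 m12 m21 m22 a1 a2
    linear_combination (norm := module) (m11 * a1) • s1 + (m12 * a1) • s2 + (m21 * a2) • s3
      + (m22 * a2) • s4 + (m21 * a1) • s5 + (m22 * a1) • s6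
  have hZ : ∀ m11 m12 m21 m22 a1 a2 : Z, (m11 * c11 + m12 * c12 + m21 * c21 + m22 * c22) •
      (a1 • z1 + a2 • z2) = (m11 * a2 - m12 * a1) • (c11 • z2) + (m21 * a2 - m22 * a1) • (c21 • z2)
      := by
    intro m11 m12 m21 m22 a1 a2
    linear_combination (norm := module) (m11 * a1) • s7 + (m21 * a1) • s8 + (m12 * a2) • s9
      + (m22 * a2) • s10 + (m12 * a1) • s11 + (m22 * a1) • s12
  have hSS' := hSS
  rw [mul_comm] at hSS'
  simp only [Matrix.mul_fin_two, H.mulUV, H.mulVU, smul_mul_assoc, mul_smul_comm, one_mul, mul_one,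
    hY, hZ, smul_smul (_ + _ + _ + _) (_ + _ + _ + _) (1 : R), hSS, hSS']
  ext k l; fin_cases k <;> fin_cases l <;> simp <;> module

theorem s4_det_zero {d1 d2 : P} (hd : d1 ≠ 0) (a1 a2 b1 b2 : Fin 4 → P)
    (h : ∀ k, a1 k * d1 + a2 k * d2 = b1 k * d1 + b2 k * d2) :
    Matrix.det (Matrix.of ![a1, a2, b1, b2]) = 0 := by
  rw [← Matrix.det_transpose, ← Matrix.exists_mulVec_eq_zero_iff]
  refine ⟨![d1, d2, -d1, -d2], fun h0 => hd (congrFun h0 0), ?_⟩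
  ext k
  simp only [Matrix.mulVec, dotProduct, Fin.sum_univ_four]
  simp
  linear_combination h k

/-- The subring of good elements. -/
def S4Data.sub (H : S4Data i e d1 d2 y1 y2 z1 z2 c11 c12 c21 c22) : Subring Z where
  carrier := {z | S4Good i e c11 c12 c21 y2 z2 z}
  add_mem' := fun h k => S4Good.add h k
  mul_mem' := fun h k => S4Good.mul h k
  zero_mem' := by simpa using H.good_i 0
  one_mem' := by simpa using H.good_i 1
  neg_mem' := fun {x} h => by
    have gn : S4Good i e c11 c12 c21 y2 z2 (-1) := by simpa using H.good_i (-1)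
    have := gn.mul h
    simpa using this

theorem S4Data.good_det (H : S4Data i e d1 d2 y1 y2 z1 z2 c11 c12 c21 c22)
    (r0 r1 r2 r3 : Fin 4 → Z)
    (h0 : ∀ k, r0 k ∈ H.sub) (h1 : ∀ k, r1 k ∈ H.sub) (h2 : ∀ k, r2 k ∈ H.sub)
    (h3 : ∀ k, r3 k ∈ H.sub) :
    Matrix.det (Matrix.of ![r0, r1, r2, r3]) ∈ H.sub := by
  rw [← Matrix.det_transpose, Matrix.det_apply]
  refine Subring.sum_mem _ fun σ _ => ?_
  rw [Units.smul_def]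
  refine Subring.zsmul_mem _ (Subring.prod_mem _ fun k _ => ?_) _
  rw [Matrix.transpose_apply]
  generalize σ k = l
  fin_cases k
  · exact h0 _
  · exact h1 _
  · exact h2 _
  · exact h3 _

theorem s4_map_det (e : Z →+* P) (r0 r1 r2 r3 : Fin 4 → Z) (v : Fin 4 → P) (hv : v ≠ 0)
    (h : ∀ k, e (r0 k) * v 0 + e (r1 k) * v 1 + e (r2 k) * v 2 + e (r3 k) * v 3 = 0) :
    e (Matrix.det (Matrix.of ![r0, r1, r2, r3])) = 0 := by
  rw [RingHom.map_det, ← Matrix.det_transpose, ← Matrix.exists_mulVec_eq_zero_iff]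
  refine ⟨v, hv, ?_⟩
  ext k
  simp only [Matrix.mulVec, dotProduct, Fin.sum_univ_four]
  simpa using h k

theorem s4_det4 (r0 r1 r2 r3 : Fin 4 → Z) : Matrix.det (Matrix.of ![r0, r1, r2, r3]) =
    r0 0 * (r1 1 * (r2 2 * r3 3 - r2 3 * r3 2) - r1 2 * (r2 1 * r3 3 - r2 3 * r3 1)
      + r1 3 * (r2 1 * r3 2 - r2 2 * r3 1))
    - r0 1 * (r1 0 * (r2 2 * r3 3 - r2 3 * r3 2) - r1 2 * (r2 0 * r3 3 - r2 3 * r3 0)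
      + r1 3 * (r2 0 * r3 2 - r2 2 * r3 0))
    + r0 2 * (r1 0 * (r2 1 * r3 3 - r2 3 * r3 1) - r1 1 * (r2 0 * r3 3 - r2 3 * r3 0)
      + r1 3 * (r2 0 * r3 1 - r2 1 * r3 0))
    - r0 3 * (r1 0 * (r2 1 * r3 2 - r2 2 * r3 1) - r1 1 * (r2 0 * r3 2 - r2 2 * r3 0)
      + r1 2 * (r2 0 * r3 1 - r2 1 * r3 0)) := by
  simp [Matrix.det_succ_row_zero, Fin.sum_univ_succ, Fin.succAbove]
  ring

theorem S4Data.main (H : S4Data i e d1 d2 y1 y2 z1 z2 c11 c12 c21 c22)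
    (A : Fin 4 → Matrix (Fin 2) (Fin 2) R)
    (hA : ∀ k, S4Mat i e d1 d2 c11 c12 c21 c22 y1 z1 y2 z2 (A k)) :
    ∑ σ : Equiv.Perm (Fin 4),
      (Equiv.Perm.sign σ : ℤ) • (A (σ 0) * A (σ 1) * A (σ 2) * A (σ 3)) = 0 := by
  choose p t a1 a2 b1 b2 hg hea heb hAe using hA
  have mp : ∀ k, p k ∈ H.sub := fun k => (hg k).1
  have mt : ∀ k, t k ∈ H.sub := fun k => (hg k).2.1
  have ma1 : ∀ k, a1 k ∈ H.sub := fun k => (hg k).2.2.1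
  have ma2 : ∀ k, a2 k ∈ H.sub := fun k => (hg k).2.2.2.1
  have mb1 : ∀ k, b1 k ∈ H.sub := fun k => (hg k).2.2.2.2.1
  have mb2 : ∀ k, b2 k ∈ H.sub := fun k => (hg k).2.2.2.2.2
  have md : ∀ k, p k - t k ∈ H.sub := fun k => Subring.sub_mem _ (mp k) (mt k)
  have E0 := s4_map_det e a1 a2 b1 b2 ![d1, d2, -d1, -d2] (fun h0 => H.d1_ne (congrFun h0 0))
    (fun k => by simp; linear_combination heb k - hea k)
  have E1 := s4_map_det e a1 a2 b1 (fun k => p k - t k) ![d1, d2, 0, -1]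
    (fun h0 => H.d1_ne (congrFun h0 0)) (fun k => by simp; linear_combination - hea k)
  have E2 := s4_map_det e a1 a2 b2 (fun k => p k - t k) ![d1, d2, 0, -1]
    (fun h0 => H.d1_ne (congrFun h0 0)) (fun k => by simp; linear_combination - hea k)
  have E3 := s4_map_det e a1 b1 b2 (fun k => p k - t k) ![0, d1, d2, -1]
    (fun h0 => H.d1_ne (congrFun h0 1)) (fun k => by simp; linear_combination - heb k)
  have E4 := s4_map_det e a2 b1 b2 (fun k => p k - t k) ![0, d1, d2, -1]
    (fun h0 => H.d1_ne (congrFun h0 1)) (fun k => by simp; linear_combination - heb k)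
  have G0 := (show S4Good i e c11 c12 c21 y2 z2 _ from H.good_det a1 a2 b1 b2 ma1 ma2 mb1 mb2).1
  have G1 := (show S4Good i e c11 c12 c21 y2 z2 _ from H.good_det a1 a2 b1 _ ma1 ma2 mb1 md).1
  have G2 := (show S4Good i e c11 c12 c21 y2 z2 _ from H.good_det a1 a2 b2 _ ma1 ma2 mb2 md).2.1
  have G3 := (show S4Good i e c11 c12 c21 y2 z2 _ from H.good_det a1 b1 b2 _ ma1 mb1 mb2 md).2.2.1
  have G4 := (show S4Good i e c11 c12 c21 y2 z2 _ from H.good_det a2 b1 b2 _ ma2 mb1 mb2 md).2.2.2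
  rw [E0, map_zero, mul_zero, zero_smul, s4_det4] at G0
  rw [E1, map_zero, mul_zero, zero_smul, s4_det4] at G1
  rw [E2, map_zero, mul_zero, zero_smul, s4_det4] at G2
  rw [E3, map_zero, mul_zero, zero_smul, s4_det4] at G3
  rw [E4, map_zero, mul_zero, zero_smul, s4_det4] at G4
  replace G0 := congrArg (· * z2) G0
  simp only [smul_mul_assoc, H.y2z2, zero_mul] at G0
  rw [s4_expand]
  simp only [hAe, H.comm_aux, H.jordan_aux]
  ext k l
  fin_cases k <;> fin_cases l <;> simp
  · linear_combination (norm := module) (-4 : Z) • G0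
  · linear_combination (norm := module) (4 : Z) • G1 + (4 : Z) • G2
  · linear_combination (norm := module) (4 : Z) • G3 + (4 : Z) • G4
  · linear_combination (norm := module) (-4 : Z) • G0


theorem S4Data.gen1 (H : S4Data i e d1 d2 y1 y2 z1 z2 c11 c12 c21 c22) (p t : P) (h : p = t + d1) :
    S4Mat i e d1 d2 c11 c12 c21 c22 y1 z1 y2 z2
      !![algebraMap Z R (i p), y1; z1, algebraMap Z R (i t)] := by
  refine ⟨_, _, _, _, _, _, ⟨H.good_i p, H.good_i t, H.good_i 1, H.good_i 0, H.good_i 1,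
    H.good_i 0⟩, ?_, ?_, ?_⟩
  · simp only [H.ei]; rw [h]; ring
  · simp only [H.ei]; rw [h]; ring
  · simp [Algebra.algebraMap_eq_smul_one]

theorem S4Data.gen2 (H : S4Data i e d1 d2 y1 y2 z1 z2 c11 c12 c21 c22) (p t : P) (h : p = t + d2) :
    S4Mat i e d1 d2 c11 c12 c21 c22 y1 z1 y2 z2
      !![algebraMap Z R (i p), y2; z2, algebraMap Z R (i t)] := by
  refine ⟨_, _, _, _, _, _, ⟨H.good_i p, H.good_i t, H.good_i 0, H.good_i 1, H.good_i 0,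
    H.good_i 1⟩, ?_, ?_, ?_⟩
  · simp only [H.ei]; rw [h]; ring
  · simp only [H.ei]; rw [h]; ring
  · simp [Algebra.algebraMap_eq_smul_one]

theorem S4Data.gen0 (H : S4Data i e d1 d2 y1 y2 z1 z2 c11 c12 c21 c22) (p t : P) (h : p = t) :
    S4Mat i e d1 d2 c11 c12 c21 c22 y1 z1 y2 z2
      !![algebraMap Z R (i p), 0; 0, algebraMap Z R (i t)] := by
  refine ⟨_, _, _, _, _, _, ⟨H.good_i p, H.good_i t, H.good_i 0, H.good_i 0, H.good_i 0,
    H.good_i 0⟩, ?_, ?_, ?_⟩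
  · simp only [H.ei]; rw [h]; ring
  · simp only [H.ei]; rw [h]; ring
  · simp [Algebra.algebraMap_eq_smul_one]

end S4abs

section S4conc
variable (K : Type*) [Field K]

theorem yg_anti (i j : Fin 4) : yg K i * yg K j = - (yg K j * yg K i) := by
  have h := ExteriorAlgebra.ι_add_mul_swap (R := K) (Pi.single i 1 : Fin 4 → K) (Pi.single j 1)
  simp only [yg, Algebra.TensorProduct.tmul_mul_tmul, mul_one]
  rw [eq_neg_of_add_eq_zero_left h, TensorProduct.tmul_neg]

theorem yg_sq (i : Fin 4) : yg K i * yg K i = 0 := by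
  simp [yg, Algebra.TensorProduct.tmul_mul_tmul]

/-- The augmentation. -/
def s4aug : FreeSuperComm K →ₐ[MvPolynomial (Fin 4) K] MvPolynomial (Fin 4) K :=
  Algebra.TensorProduct.lift (AlgHom.id _ _)
    ((Algebra.ofId K (MvPolynomial (Fin 4) K)).comp ExteriorAlgebra.algebraMapInv)
    (fun _ _ => Commute.all _ _)

theorem s4aug_yg (i : Fin 4) : s4aug K (yg K i) = 0 := by
  simp [s4aug, yg, ExteriorAlgebra.algebraMapInv]

theorem yg_comm2 (i j : Fin 4) :
    yg K i * yg K j ∈ Subalgebra.center (MvPolynomial (Fin 4) K) (FreeSuperComm K) := by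
  rw [Subalgebra.mem_center_iff]
  intro b
  induction b using TensorProduct.induction_on with
  | zero => simp
  | add x y hx hy => rw [add_mul, mul_add, hx, hy]
  | tmul p v =>
    simp only [yg, Algebra.TensorProduct.tmul_mul_tmul, mul_one, one_mul]
    congr 1
    induction v using ExteriorAlgebra.induction with
    | algebraMap r => exact Algebra.commutes _ _
    | ι x =>
      have h := fun x y => eq_neg_of_add_eq_zero_left
        (ExteriorAlgebra.ι_add_mul_swap (R := K) (x : Fin 4 → K) y)
      rw [← mul_assoc, h, neg_mul, mul_assoc, h x, mul_neg, neg_neg, mul_assoc]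
    | mul a b ha hb => rw [mul_assoc, hb, ← mul_assoc, ha, mul_assoc]
    | add a b ha hb => rw [add_mul, mul_add, ha, hb]

/-- The centre. -/
abbrev S4Cen := Subalgebra.center (MvPolynomial (Fin 4) K) (FreeSuperComm K)

instance s4Alg : Algebra (S4Cen K) (FreeSuperComm K) :=
  RingHom.toAlgebra' ((S4Cen K).val : S4Cen K →+* FreeSuperComm K)
    (fun c x => (Subalgebra.mem_center_iff.1 c.2 x).symm)

theorem s4data : S4Data (P := MvPolynomial (Fin 4) K) (Z := S4Cen K) (R := FreeSuperComm K)
    (algebraMap (MvPolynomial (Fin 4) K) (S4Cen K))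
    (((s4aug K).comp (S4Cen K).val : _ →ₐ[MvPolynomial (Fin 4) K] _) : S4Cen K →+* _)
    (MvPolynomial.X 0 - MvPolynomial.X 1) (MvPolynomial.X 2 - MvPolynomial.X 3)
    (yg K 0) (yg K 2) (yg K 1) (yg K 3)
    ⟨_, yg_comm2 K 0 1⟩ ⟨_, yg_comm2 K 0 3⟩ ⟨_, yg_comm2 K 2 1⟩ ⟨_, yg_comm2 K 2 3⟩ where
  ei p := by
    exact ((s4aug K).comp (S4Cen K).val).commutes p
  d1_ne := by
    rw [sub_ne_zero]
    exact fun h => absurd (MvPolynomial.X_injective h) (by decide)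
  inj := Subtype.val_injective
  y1z1 := (mul_one _).symm
  y1z2 := (mul_one _).symm
  y2z1 := (mul_one _).symm
  y2z2 := (mul_one _).symm
  z1y1 := (yg_anti K 1 0).trans (congrArg _ (mul_one _).symm)
  z2y1 := (yg_anti K 3 0).trans (congrArg _ (mul_one _).symm)
  z1y2 := (yg_anti K 1 2).trans (congrArg _ (mul_one _).symm)
  z2y2 := (yg_anti K 3 2).trans (congrArg _ (mul_one _).symm)
  y11 := yg_sq K _
  y22 := yg_sq K _
  y21 := yg_anti K _ _
  z11 := yg_sq K _
  z22 := yg_sq K _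
  z21 := yg_anti K _ _
  e11 := (map_mul (s4aug K) _ _).trans (by rw [s4aug_yg, zero_mul])
  e12 := (map_mul (s4aug K) _ _).trans (by rw [s4aug_yg, zero_mul])
  e21 := (map_mul (s4aug K) _ _).trans (by rw [s4aug_yg, zero_mul])
  e22 := (map_mul (s4aug K) _ _).trans (by rw [s4aug_yg, zero_mul])

theorem s4_i_smul (p : MvPolynomial (Fin 4) K) :
    algebraMap (S4Cen K) (FreeSuperComm K) (algebraMap (MvPolynomial (Fin 4) K) (S4Cen K) p)
      = p ⊗ₜ[K] 1 := rfl

end S4conc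

/- STATEMENT 3: the standard polynomial s4 is a polynomial identity of F. -/
theorem stmt3 (K : Type*) [Field K] [CharZero K]
    (a : Fin 4 → Matrix (Fin 2) (Fin 2) (FreeSuperComm K))
    (h : ∀ i, a i ∈ Falg K) :
    ∑ σ : Equiv.Perm (Fin 4),
      (Equiv.Perm.sign σ : ℤ) • (a (σ 0) * a (σ 1) * a (σ 2) * a (σ 3)) = 0 := by
  have H := s4data K
  refine H.main a fun k => ?_
  have hk := h k
  generalize a k = A at hk
  unfold Falg at hk
  induction hk using Algebra.adjoin_induction with
  | mem x hx =>
    rcases hx with rfl | rfl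
    · exact H.gen1 (MvPolynomial.X 0) (MvPolynomial.X 1) (by ring)
    · exact H.gen2 (MvPolynomial.X 2) (MvPolynomial.X 3) (by ring)
  | algebraMap r =>
    have h0 := H.gen0 (algebraMap K _ r) _ rfl
    rw [s4_i_smul] at h0
    have hr : (algebraMap K (MvPolynomial (Fin 4) K) r) ⊗ₜ[K] (1 : ExteriorAlgebra K (Fin 4 → K))
        = algebraMap K (FreeSuperComm K) r := by
      simp [Algebra.TensorProduct.algebraMap_apply]
    rw [hr] at h0
    convert h0 using 1
    ext k l
    fin_cases k <;> fin_cases l <;> simp [Matrix.algebraMap_matrix_apply]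
  | add x y _ _ hx hy => exact hx.add hy
  | mul x y _ _ hx hy => exact H.mat_mul hx hy
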